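/- arXiv:1309.1564 — 3 statements merged into one kernel-verified Lean document; each statement's English description precedes it below -/
import Mathlib

section
/- Let A be an m×n integer matrix with rows A_1,…,A_m ∈ ℤⁿ, let c ∈ ℂ^m, fix i ∈ {1,…,n} and j ∈ {1,…,m}, and suppose the i-th entry A_{j,i} of the row A_j satisfies A_{j,i} ≤ 0. Then for every holomorphic function f on an open set U ⊆ {x ∈ ℂⁿ : x_1⋯x_n ≠ 0} one has the operator identity (⟨A_j, θ⟩ − A_{j,i} + c_j − 1)(H_i(A, c − e_j) f) = H_i(A, c)((⟨A_j, θ⟩ + c_j − 1) f) on U, where H_i(A,c) f := x_i P_i(θ)f − Q_i(θ)f is the i-th Horn operator and e_j ∈ ℂ^m is the j-th standard basis vector. -/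
open scoped BigOperators

/-- The operator `θ_k = x_k ∂/∂x_k` acting on functions of `n` complex variables. -/
noncomputable def th {n : ℕ} (k : Fin n) (f : (Fin n → ℂ) → ℂ) : (Fin n → ℂ) → ℂ :=
  fun x => x k * fderiv ℂ f x (Pi.single k 1)

/-- The first-order operator `⟨a, θ⟩ + c`. -/
noncomputable def linFactor {n : ℕ} (a : Fin n → ℤ) (c : ℂ) (f : (Fin n → ℂ) → ℂ) :
    (Fin n → ℂ) → ℂ :=
  fun x => (∑ k, (a k : ℂ) * th k f x) + c * f x

/-- The operator `∏_{ℓ=0}^{N-1} (⟨a, θ⟩ + c + ℓ)` (the factors commute). -/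
noncomputable def factorPow {n : ℕ} (a : Fin n → ℤ) (c : ℂ) :
    ℕ → ((Fin n → ℂ) → ℂ) → ((Fin n → ℂ) → ℂ)
  | 0 => id
  | N + 1 => fun f => linFactor a (c + N) (factorPow a c N f)

/-- The operator `P_k(θ)` of the Horn system `Horn(A, c)`. -/
noncomputable def Pop {m n : ℕ} (A : Fin m → Fin n → ℤ) (c : Fin m → ℂ) (k : Fin n)
    (f : (Fin n → ℂ) → ℂ) : (Fin n → ℂ) → ℂ :=
  (List.finRange m).foldr
    (fun i g => if 0 < A i k then factorPow (A i) (c i) (A i k).toNat g else g) f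

/-- The operator `Q_k(θ)` of the Horn system `Horn(A, c)`. -/
noncomputable def Qop {m n : ℕ} (A : Fin m → Fin n → ℤ) (c : Fin m → ℂ) (k : Fin n)
    (f : (Fin n → ℂ) → ℂ) : (Fin n → ℂ) → ℂ :=
  (List.finRange m).foldr
    (fun i g => if A i k < 0 then factorPow (A i) (c i) (A i k).natAbs g else g) f

/-- The `i`-th Horn operator `H_i(A,c) f = x_i P_i(θ) f - Q_i(θ) f`. -/
noncomputable def Hop {m n : ℕ} (A : Fin m → Fin n → ℤ) (c : Fin m → ℂ) (i : Fin n)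
    (f : (Fin n → ℂ) → ℂ) : (Fin n → ℂ) → ℂ :=
  fun x => x i * Pop A c i f x - Qop A c i f x

/-- The Euler-type linear vector field `x ↦ (a_k x_k)_k`. -/
noncomputable def diagField {n : ℕ} (a : Fin n → ℤ) : (Fin n → ℂ) →L[ℂ] (Fin n → ℂ) :=
  ContinuousLinearMap.pi fun k => (a k : ℂ) • ContinuousLinearMap.proj k

theorem diagField_apply {n : ℕ} (a : Fin n → ℤ) (x : Fin n → ℂ) (k : Fin n) :
    diagField a x k = a k * x k := by
  simp [diagField]

theorem diagField_comm {n : ℕ} (a b : Fin n → ℤ) (x : Fin n → ℂ) :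
    diagField a (diagField b x) = diagField b (diagField a x) := by
  ext k
  simp only [diagField_apply]
  ring

theorem linFactor_apply {n : ℕ} (a : Fin n → ℤ) (c : ℂ) (f : (Fin n → ℂ) → ℂ)
    (x : Fin n → ℂ) :
    linFactor a c f x = fderiv ℂ f x (diagField a x) + c * f x := by
  have h : diagField a x = ∑ k, ((a k : ℂ) * x k) • (Pi.single k 1 : Fin n → ℂ) := by
    ext k
    simp [diagField_apply, Finset.sum_apply, Pi.single_apply]
  rw [h, map_sum]
  simp only [linFactor, th, map_smul, smul_eq_mul, mul_assoc]

theorem AnalyticOnNhd.linFactor {n : ℕ} {a : Fin n → ℤ} {c : ℂ} {U : Set (Fin n → ℂ)}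
    {f : (Fin n → ℂ) → ℂ} (hf : AnalyticOnNhd ℂ f U) :
    AnalyticOnNhd ℂ (linFactor a c f) U := by
  have h : _root_.linFactor a c f = fun x => fderiv ℂ f x (diagField a x) + c * f x :=
    funext (linFactor_apply a c f)
  rw [h]
  intro x hx
  have happ := (ContinuousLinearMap.id ℂ ((Fin n → ℂ) →L[ℂ] ℂ)).analyticAt_bilinear
    (fderiv ℂ f x, diagField a x)
  exact (happ.comp₂ (hf.fderiv x hx) ((diagField a).analyticAt x)).add
    (analyticAt_const.mul (hf x hx))

theorem Set.EqOn.linFactor {n : ℕ} {a : Fin n → ℤ} {c : ℂ} {U : Set (Fin n → ℂ)}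
    (hU : IsOpen U) {f g : (Fin n → ℂ) → ℂ} (h : Set.EqOn f g U) :
    Set.EqOn (linFactor a c f) (linFactor a c g) U := by
  intro x hx
  rw [linFactor_apply, linFactor_apply, h hx,
    (h.eventuallyEq_of_mem (hU.mem_nhds hx)).fderiv_eq]

theorem fderiv_linFactor_apply {n : ℕ} (a b : Fin n → ℤ) (d : ℂ) {f : (Fin n → ℂ) → ℂ}
    {x : Fin n → ℂ} (hf : AnalyticAt ℂ f x) :
    fderiv ℂ (linFactor b d f) x (diagField a x) =
      fderiv ℂ (fderiv ℂ f) x (diagField a x) (diagField b x)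
        + fderiv ℂ f x (diagField b (diagField a x)) + d * fderiv ℂ f x (diagField a x) := by
  have h : linFactor b d f = fun x => fderiv ℂ f x (diagField b x) + d * f x :=
    funext (linFactor_apply b d f)
  have h₁ := (hf.fderiv.differentiableAt.hasFDerivAt.clm_apply
    (diagField b).hasFDerivAt).add (hf.differentiableAt.hasFDerivAt.const_mul d)
  have h₂ : fderiv ℂ (fun x => fderiv ℂ f x (diagField b x) + d * f x) x = _ :=
    HasFDerivAt.fderiv h₁
  rw [h, h₂]
  simp
  ring

theorem linFactor_comm {n : ℕ} (a b : Fin n → ℤ) (c d : ℂ) {f : (Fin n → ℂ) → ℂ}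
    {x : Fin n → ℂ} (hf : AnalyticAt ℂ f x) :
    linFactor a c (linFactor b d f) x = linFactor b d (linFactor a c f) x := by
  have hsymm : IsSymmSndFDerivAt ℂ f x :=
    (hf.contDiffAt (n := 2)).isSymmSndFDerivAt (by simp)
  rw [linFactor_apply a c, linFactor_apply b d (linFactor a c f), fderiv_linFactor_apply a b d hf,
    fderiv_linFactor_apply b a c hf, linFactor_apply, linFactor_apply, diagField_comm a b,
    hsymm.eq (diagField a x)]
  ring

theorem linFactor_sub {n : ℕ} (a : Fin n → ℤ) (c : ℂ) {f g : (Fin n → ℂ) → ℂ}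
    {x : Fin n → ℂ} (hf : DifferentiableAt ℂ f x) (hg : DifferentiableAt ℂ g x) :
    linFactor a c (fun y => f y - g y) x = linFactor a c f x - linFactor a c g x := by
  simp only [linFactor_apply]
  rw [fderiv_fun_sub hf hg, sub_apply]
  ring

theorem linFactor_coord_mul {n : ℕ} (a : Fin n → ℤ) (c : ℂ) (i : Fin n)
    {f : (Fin n → ℂ) → ℂ} {x : Fin n → ℂ} (hf : DifferentiableAt ℂ f x) :
    linFactor a c (fun y => y i * f y) x = x i * linFactor a (a i + c) f x := by
  have h := (hasFDerivAt_apply (𝕜 := ℂ) i x).mul hf.hasFDerivAt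
  have h' : fderiv ℂ (fun y : Fin n → ℂ => y i * f y) x = _ := HasFDerivAt.fderiv h
  simp only [linFactor_apply]
  rw [h']
  simp [diagField_apply]
  ring

/-- Operators that act on holomorphic functions on `U` and commute there with every
first-order operator `⟨a, θ⟩ + c`. -/
structure CommutesWithTheta {n : ℕ} (U : Set (Fin n → ℂ))
    (T : ((Fin n → ℂ) → ℂ) → ((Fin n → ℂ) → ℂ)) : Prop where
  analytic : ∀ {f}, AnalyticOnNhd ℂ f U → AnalyticOnNhd ℂ (T f) U
  congr : ∀ {f g}, Set.EqOn f g U → Set.EqOn (T f) (T g) U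
  comm : ∀ {f} (a : Fin n → ℤ) (c : ℂ), AnalyticOnNhd ℂ f U →
    Set.EqOn (linFactor a c (T f)) (T (linFactor a c f)) U

namespace CommutesWithTheta

variable {n : ℕ} {U : Set (Fin n → ℂ)}

theorem id : CommutesWithTheta U id :=
  ⟨fun h => h, fun h => h, fun _ _ _ => Set.eqOn_refl _ _⟩

theorem comp {S T : ((Fin n → ℂ) → ℂ) → ((Fin n → ℂ) → ℂ)}
    (hS : CommutesWithTheta U S) (hT : CommutesWithTheta U T) :
    CommutesWithTheta U fun f => S (T f) :=
  ⟨fun h => hS.analytic (hT.analytic h), fun h => hS.congr (hT.congr h),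
    fun a c h => (hS.comm a c (hT.analytic h)).trans (hS.congr (hT.comm a c h))⟩

theorem linFactor (hU : IsOpen U) (b : Fin n → ℤ) (d : ℂ) :
    CommutesWithTheta U (linFactor b d) :=
  ⟨fun h => h.linFactor, fun h => h.linFactor hU,
    fun a c h x hx => linFactor_comm a b c d (h x hx)⟩

theorem factorPow (hU : IsOpen U) (b : Fin n → ℤ) (d : ℂ) (N : ℕ) :
    CommutesWithTheta U (factorPow b d N) := by
  induction N with
  | zero => exact id
  | succ N ih =>
    have h := comp (linFactor hU b (d + N)) ih
    exact h

theorem foldr {ι : Type*} {T : ι → ((Fin n → ℂ) → ℂ) → ((Fin n → ℂ) → ℂ)}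
    (hT : ∀ i, CommutesWithTheta U (T i)) (l : List ι) :
    CommutesWithTheta U fun f => l.foldr T f := by
  induction l with
  | nil => exact id
  | cons i l ih => exact comp (hT i) ih

theorem ite {p : Prop} [Decidable p] {T : ((Fin n → ℂ) → ℂ) → ((Fin n → ℂ) → ℂ)}
    (hT : CommutesWithTheta U T) : CommutesWithTheta U fun f => if p then T f else f := by
  by_cases hp : p
  · simpa [hp] using hT
  · simp only [hp, if_false]
    exact id

end CommutesWithTheta

theorem linFactor_factorPow {n : ℕ} {U : Set (Fin n → ℂ)} (hU : IsOpen U) (a : Fin n → ℤ)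
    (c : ℂ) (N : ℕ) {f : (Fin n → ℂ) → ℂ} :
    Set.EqOn (linFactor a (c + N) (factorPow a c N f))
      (factorPow a (c + 1) N (linFactor a c f)) U := by
  induction N with
  | zero => simp [factorPow, Set.eqOn_refl]
  | succ N ih =>
    have h : c + ((N + 1 : ℕ) : ℂ) = c + 1 + N := by
      push_cast
      ring
    rw [h]
    exact ih.linFactor hU

/-- The `k`-th factor of `Q_i(θ)`. -/
noncomputable def qFactor {m n : ℕ} (A : Fin m → Fin n → ℤ) (c : Fin m → ℂ) (i : Fin n)
    (k : Fin m) (g : (Fin n → ℂ) → ℂ) : (Fin n → ℂ) → ℂ :=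
  if A k i < 0 then factorPow (A k) (c k) (A k i).natAbs g else g

theorem CommutesWithTheta.qFactor {m n : ℕ} {U : Set (Fin n → ℂ)} (hU : IsOpen U)
    (A : Fin m → Fin n → ℤ) (c : Fin m → ℂ) (i : Fin n) (k : Fin m) :
    CommutesWithTheta U (qFactor A c i k) :=
  (CommutesWithTheta.factorPow hU _ _ _).ite

theorem CommutesWithTheta.pop {m n : ℕ} {U : Set (Fin n → ℂ)} (hU : IsOpen U)
    (A : Fin m → Fin n → ℤ) (c : Fin m → ℂ) (i : Fin n) :
    CommutesWithTheta U (Pop A c i) :=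
  .foldr (fun _ => (CommutesWithTheta.factorPow hU _ _ _).ite) _

theorem CommutesWithTheta.qop {m n : ℕ} {U : Set (Fin n → ℂ)} (hU : IsOpen U)
    (A : Fin m → Fin n → ℤ) (c : Fin m → ℂ) (i : Fin n) :
    CommutesWithTheta U (Qop A c i) :=
  .foldr (CommutesWithTheta.qFactor hU A c i) _

theorem Pop_sub_single {m n : ℕ} {A : Fin m → Fin n → ℤ} (c : Fin m → ℂ) {i : Fin n}
    {j : Fin m} (hA : A j i ≤ 0) : Pop A (c - Pi.single j 1) i = Pop A c i := by
  funext f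
  unfold Pop
  congr 1
  funext k g
  rcases eq_or_ne k j with rfl | hk
  · simp [hA.not_gt]
  · simp [hk]

theorem qFactor_sub_single_of_ne {m n : ℕ} (A : Fin m → Fin n → ℤ) (c : Fin m → ℂ)
    (i : Fin n) {j k : Fin m} (hk : k ≠ j) :
    qFactor A (c - Pi.single j 1) i k = qFactor A c i k := by
  funext g
  simp [qFactor, hk]

theorem linFactor_qFactor_sub_single {m n : ℕ} {U : Set (Fin n → ℂ)} (hU : IsOpen U)
    {A : Fin m → Fin n → ℤ} (c : Fin m → ℂ) {i : Fin n} {j : Fin m} (hA : A j i ≤ 0)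
    (f : (Fin n → ℂ) → ℂ) :
    Set.EqOn (linFactor (A j) (-(A j i : ℂ) + c j - 1) (qFactor A (c - Pi.single j 1) i j f))
      (qFactor A c i j (linFactor (A j) (c j - 1) f)) U := by
  rcases hA.lt_or_eq with h | h
  · have hN : -(A j i : ℂ) + c j - 1 = (c j - 1) + ((A j i).natAbs : ℂ) := by
      have habs : ((A j i).natAbs : ℂ) = -(A j i : ℂ) := by
        rw [Nat.cast_natAbs, abs_of_neg h, Int.cast_neg]
      rw [habs]
      ring
    rw [hN]
    simpa [qFactor, h] using linFactor_factorPow hU (A j) (c j - 1) (A j i).natAbs (f := f)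
  · simp [qFactor, h, Set.eqOn_refl]

theorem linFactor_foldr_qFactor_sub_single {m n : ℕ} {U : Set (Fin n → ℂ)} (hU : IsOpen U)
    {A : Fin m → Fin n → ℤ} (c : Fin m → ℂ) {i : Fin n} {j : Fin m} (hA : A j i ≤ 0)
    {f : (Fin n → ℂ) → ℂ} (hf : AnalyticOnNhd ℂ f U) {l : List (Fin m)} (hl : l.Nodup)
    (hj : j ∈ l) :
    Set.EqOn
      (linFactor (A j) (-(A j i : ℂ) + c j - 1) (l.foldr (qFactor A (c - Pi.single j 1) i) f))
      (l.foldr (qFactor A c i) (linFactor (A j) (c j - 1) f)) U := by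
  induction l with
  | nil => simp at hj
  | cons k l ih =>
    obtain ⟨hkl, hl⟩ := List.nodup_cons.mp hl
    simp only [List.foldr_cons]
    rcases eq_or_ne k j with rfl | hk
    · have hfold : l.foldr (qFactor A (c - Pi.single k 1) i) f = l.foldr (qFactor A c i) f :=
        List.foldr_ext _ _ _ fun b hb g =>
          congrFun (qFactor_sub_single_of_ne A c i (ne_of_mem_of_not_mem hb hkl)) g
      rw [hfold]
      exact (linFactor_qFactor_sub_single hU c hA _).trans
        ((CommutesWithTheta.qFactor hU A c i k).congr
          ((CommutesWithTheta.foldr (CommutesWithTheta.qFactor hU A c i) l).comm _ _ hf))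
    · have hjl : j ∈ l := (List.mem_cons.mp hj).resolve_left hk.symm
      rw [qFactor_sub_single_of_ne A c i hk]
      have hq := CommutesWithTheta.qFactor hU A c i k
      exact (hq.comm _ _ ((CommutesWithTheta.foldr
        (CommutesWithTheta.qFactor hU A (c - Pi.single j 1) i) l).analytic hf)).trans
          (hq.congr (ih hl hjl))

theorem linFactor_Qop_sub_single {m n : ℕ} {U : Set (Fin n → ℂ)} (hU : IsOpen U)
    {A : Fin m → Fin n → ℤ} (c : Fin m → ℂ) {i : Fin n} {j : Fin m} (hA : A j i ≤ 0)
    {f : (Fin n → ℂ) → ℂ} (hf : AnalyticOnNhd ℂ f U) :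
    Set.EqOn (linFactor (A j) (-(A j i : ℂ) + c j - 1) (Qop A (c - Pi.single j 1) i f))
      (Qop A c i (linFactor (A j) (c j - 1) f)) U :=
  linFactor_foldr_qFactor_sub_single hU c hA hf (List.nodup_finRange m) (List.mem_finRange j)

/-- Operator identity behind the intertwining operators of Horn systems, in the case
`A_{j,i} ≤ 0`:  `(⟨A_j, θ⟩ - A_{j,i} + c_j - 1)(H_i(A, c - e_j) f)
  = H_i(A, c)((⟨A_j, θ⟩ + c_j - 1) f)` on `U`. -/
theorem stmt1 {m n : ℕ} (A : Fin m → Fin n → ℤ) (c : Fin m → ℂ) (i : Fin n) (j : Fin m)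
    (hA : A j i ≤ 0)
    (U : Set (Fin n → ℂ)) (hUopen : IsOpen U) (hU : U ⊆ {x | (∏ k, x k) ≠ 0})
    (f : (Fin n → ℂ) → ℂ) (hf : AnalyticOnNhd ℂ f U) :
    ∀ x ∈ U,
      (∑ k, (A j k : ℂ) * th k (Hop A (c - Pi.single j 1) i f) x)
          + (-(A j i : ℂ) + c j - 1) * Hop A (c - Pi.single j 1) i f x
        = Hop A c i (fun y => (∑ k, (A j k : ℂ) * th k f y) + (c j - 1) * f y) x := by
  intro x hx
  have hP := (CommutesWithTheta.pop hUopen A c i).analytic hf x hx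
  have hQ := (CommutesWithTheta.qop hUopen A (c - Pi.single j 1) i).analytic hf x hx
  change linFactor (A j) (-(A j i : ℂ) + c j - 1) (fun y =>
      y i * Pop A (c - Pi.single j 1) i f y - Qop A (c - Pi.single j 1) i f y) x =
    x i * Pop A c i (linFactor (A j) (c j - 1) f) x - Qop A c i (linFactor (A j) (c j - 1) f) x
  have hxP : DifferentiableAt ℂ (fun y => y i * Pop A c i f y) x :=
    (differentiableAt_apply i x).mul hP.differentiableAt
  rw [Pop_sub_single c hA, linFactor_sub _ _ hxP hQ.differentiableAt,
    linFactor_coord_mul _ _ _ hP.differentiableAt, linFactor_Qop_sub_single hUopen c hA hf hx,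
    ← (CommutesWithTheta.pop hUopen A c i).comm _ _ hf hx]
  ring_nf
end

section
/- Let ε_1, ε_2 ∈ {1, −1} with (ε_1, ε_2) ≠ (1,1). The function f(x) = log(1 + x_1^{1/2} + x_2^{1/2}) − log(1 + ε_1 x_1^{1/2} + ε_2 x_2^{1/2}) (principal branches) satisfies the two equations x_1(2θ_1 + 2θ_2)(2θ_1 + 2θ_2 + 1)f = 2θ_1(2θ_1 − 1)f and x_2(2θ_1 + 2θ_2)(2θ_1 + 2θ_2 + 1)f = 2θ_2(2θ_2 − 1)f on the open set {x ∈ ℂ² : x_1 ∉ (−∞,0], x_2 ∉ (−∞,0], 1 + x_1^{1/2} + x_2^{1/2} ∉ (−∞,0], 1 + ε_1 x_1^{1/2} + ε_2 x_2^{1/2} ∉ (−∞,0]}. (The additional resonant logarithmic solutions, for parameter c = 0, of the simplicial Horn system defined by the matrix with rows (−2,0), (0,−2), (2,2).) -/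
open scoped BigOperators

/-- The operator `θ₁ = x₁ ∂/∂x₁` acting on functions of two complex variables. -/
noncomputable def th1 (f : ℂ × ℂ → ℂ) : ℂ × ℂ → ℂ := fun p => p.1 * fderiv ℂ f p (1, 0)

/-- The operator `θ₂ = x₂ ∂/∂x₂` acting on functions of two complex variables. -/
noncomputable def th2 (f : ℂ × ℂ → ℂ) : ℂ × ℂ → ℂ := fun p => p.2 * fderiv ℂ f p (0, 1)

/-- The first-order operator `a θ₁ + b θ₂ + c`. -/
noncomputable def lin2 (a b c : ℂ) (f : ℂ × ℂ → ℂ) : ℂ × ℂ → ℂ :=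
  fun p => a * th1 f p + b * th2 f p + c * f p

/-- The operator `∏_{ℓ=0}^{N-1} (a θ₁ + b θ₂ + c + ℓ)` (the factors commute). -/
noncomputable def linPow2 (a b c : ℂ) : ℕ → (ℂ × ℂ → ℂ) → (ℂ × ℂ → ℂ)
  | 0 => id
  | N + 1 => fun f => lin2 a b (c + N) (linPow2 a b c N f)

/-- The resonant logarithmic solution
`log(1 + √x₁ + √x₂) - log(1 + ε₁√x₁ + ε₂√x₂)` (principal branches). -/
noncomputable def glog (ε₁ ε₂ : ℂ) : ℂ × ℂ → ℂ :=
  fun q => Complex.log (1 + q.1 ^ ((1 : ℂ) / 2) + q.2 ^ ((1 : ℂ) / 2)) -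
    Complex.log (1 + ε₁ * q.1 ^ ((1 : ℂ) / 2) + ε₂ * q.2 ^ ((1 : ℂ) / 2))

/-- The affine form `1 + a √x₁ + b √x₂`. -/
noncomputable def sqrtForm (a b : ℂ) (q : ℂ × ℂ) : ℂ :=
  1 + a * q.1 ^ ((1 : ℂ) / 2) + b * q.2 ^ ((1 : ℂ) / 2)

theorem glog_eq_log_sqrtForm (a b : ℂ) :
    glog a b = fun q => Complex.log (sqrtForm 1 1 q) - Complex.log (sqrtForm a b q) := by
  funext q
  simp only [glog, sqrtForm, one_mul]

theorem sq_cpow_half (z : ℂ) : (z ^ ((1 : ℂ) / 2)) ^ 2 = z := by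
  rw [one_div]
  exact_mod_cast Complex.cpow_nat_inv_pow z two_ne_zero

theorem hasDerivAt_cpow_half {z : ℂ} (hz : z ∈ Complex.slitPlane) :
    HasDerivAt (fun w : ℂ => w ^ ((1 : ℂ) / 2)) (z ^ ((1 : ℂ) / 2) / (2 * z)) z := by
  have h0 : z ≠ 0 := Complex.slitPlane_ne_zero hz
  have h := (hasDerivAt_id' z).cpow_const (c := (1 : ℂ) / 2) hz
  rw [Complex.cpow_sub _ _ h0, Complex.cpow_one] at h
  exact h.congr_deriv (by ring)

theorem hasFDerivAt_fst_cpow_half {p : ℂ × ℂ} (h : p.1 ∈ Complex.slitPlane) :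
    HasFDerivAt (fun q : ℂ × ℂ => q.1 ^ ((1 : ℂ) / 2))
      ((p.1 ^ ((1 : ℂ) / 2) / (2 * p.1)) • ContinuousLinearMap.fst ℂ ℂ ℂ) p :=
  (hasDerivAt_cpow_half h).comp_hasFDerivAt p hasFDerivAt_fst

theorem hasFDerivAt_snd_cpow_half {p : ℂ × ℂ} (h : p.2 ∈ Complex.slitPlane) :
    HasFDerivAt (fun q : ℂ × ℂ => q.2 ^ ((1 : ℂ) / 2))
      ((p.2 ^ ((1 : ℂ) / 2) / (2 * p.2)) • ContinuousLinearMap.snd ℂ ℂ ℂ) p :=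
  (hasDerivAt_cpow_half h).comp_hasFDerivAt p hasFDerivAt_snd

theorem hasFDerivAt_sqrtForm (a b : ℂ) {p : ℂ × ℂ} (h₁ : p.1 ∈ Complex.slitPlane)
    (h₂ : p.2 ∈ Complex.slitPlane) :
    HasFDerivAt (sqrtForm a b)
      (a • ((p.1 ^ ((1 : ℂ) / 2) / (2 * p.1)) • ContinuousLinearMap.fst ℂ ℂ ℂ) +
        b • ((p.2 ^ ((1 : ℂ) / 2) / (2 * p.2)) • ContinuousLinearMap.snd ℂ ℂ ℂ)) p :=
  (((hasFDerivAt_fst_cpow_half h₁).const_mul a).const_add 1).add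
    ((hasFDerivAt_snd_cpow_half h₂).const_mul b)

theorem th1_eq_of_hasFDerivAt {f g : ℂ × ℂ → ℂ} {g' : ℂ × ℂ →L[ℂ] ℂ} {p : ℂ × ℂ}
    (h : f =ᶠ[nhds p] g) (hg : HasFDerivAt g g' p) : th1 f p = p.1 * g' (1, 0) := by
  rw [th1, h.fderiv_eq, hg.fderiv]

theorem th2_eq_of_hasFDerivAt {f g : ℂ × ℂ → ℂ} {g' : ℂ × ℂ →L[ℂ] ℂ} {p : ℂ × ℂ}
    (h : f =ᶠ[nhds p] g) (hg : HasFDerivAt g g' p) : th2 f p = p.2 * g' (0, 1) := by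
  rw [th2, h.fderiv_eq, hg.fderiv]

/-- The domain on which all the square roots and logarithms in `glog a b` are holomorphic. -/
def glogDomain (a b : ℂ) : Set (ℂ × ℂ) :=
  {p | p.1 ∈ Complex.slitPlane ∧ p.2 ∈ Complex.slitPlane ∧
    sqrtForm 1 1 p ∈ Complex.slitPlane ∧ sqrtForm a b p ∈ Complex.slitPlane}

theorem eventually_mem_glogDomain {a b : ℂ} {p : ℂ × ℂ} (hp : p ∈ glogDomain a b) :
    ∀ᶠ q in nhds p, q ∈ glogDomain a b := by
  obtain ⟨h₁, h₂, h₃, h₄⟩ := hp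
  have ho := Complex.isOpen_slitPlane
  filter_upwards [continuousAt_fst.eventually (ho.mem_nhds h₁),
    continuousAt_snd.eventually (ho.mem_nhds h₂),
    (hasFDerivAt_sqrtForm 1 1 h₁ h₂).continuousAt.eventually (ho.mem_nhds h₃),
    (hasFDerivAt_sqrtForm a b h₁ h₂).continuousAt.eventually (ho.mem_nhds h₄)]
    with q k₁ k₂ k₃ k₄
  exact ⟨k₁, k₂, k₃, k₄⟩

theorem hasFDerivAt_glog {a b : ℂ} {p : ℂ × ℂ} (hp : p ∈ glogDomain a b) :
    HasFDerivAt (glog a b)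
      ((sqrtForm 1 1 p)⁻¹ •
        ((1 : ℂ) • ((p.1 ^ ((1 : ℂ) / 2) / (2 * p.1)) • ContinuousLinearMap.fst ℂ ℂ ℂ) +
        (1 : ℂ) • ((p.2 ^ ((1 : ℂ) / 2) / (2 * p.2)) • ContinuousLinearMap.snd ℂ ℂ ℂ)) -
      (sqrtForm a b p)⁻¹ •
        (a • ((p.1 ^ ((1 : ℂ) / 2) / (2 * p.1)) • ContinuousLinearMap.fst ℂ ℂ ℂ) +
        b • ((p.2 ^ ((1 : ℂ) / 2) / (2 * p.2)) • ContinuousLinearMap.snd ℂ ℂ ℂ))) p := by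
  obtain ⟨h₁, h₂, h₃, h₄⟩ := hp
  rw [glog_eq_log_sqrtForm]
  exact ((hasFDerivAt_sqrtForm 1 1 h₁ h₂).clog h₃).sub
    ((hasFDerivAt_sqrtForm a b h₁ h₂).clog h₄)

theorem hasFDerivAt_inv_sqrtForm (a b : ℂ) {p : ℂ × ℂ} (h₁ : p.1 ∈ Complex.slitPlane)
    (h₂ : p.2 ∈ Complex.slitPlane) (h : sqrtForm a b p ≠ 0) :
    HasFDerivAt (fun q => (sqrtForm a b q)⁻¹)
      ((-(sqrtForm a b p ^ 2)⁻¹) •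
      (a • ((p.1 ^ ((1 : ℂ) / 2) / (2 * p.1)) • ContinuousLinearMap.fst ℂ ℂ ℂ) +
        b • ((p.2 ^ ((1 : ℂ) / 2) / (2 * p.2)) • ContinuousLinearMap.snd ℂ ℂ ℂ))) p :=
  (hasDerivAt_inv h).comp_hasFDerivAt p (hasFDerivAt_sqrtForm a b h₁ h₂)

theorem th1_glog {a b : ℂ} {p : ℂ × ℂ} (hp : p ∈ glogDomain a b) :
    th1 (glog a b) p =
      p.1 ^ ((1 : ℂ) / 2) * ((sqrtForm 1 1 p)⁻¹ - a * (sqrtForm a b p)⁻¹) / 2 := by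
  have h0 : p.1 ≠ 0 := Complex.slitPlane_ne_zero hp.1
  rw [th1_eq_of_hasFDerivAt Filter.EventuallyEq.rfl (hasFDerivAt_glog hp)]
  simp
  field_simp

theorem th2_glog {a b : ℂ} {p : ℂ × ℂ} (hp : p ∈ glogDomain a b) :
    th2 (glog a b) p =
      p.2 ^ ((1 : ℂ) / 2) * ((sqrtForm 1 1 p)⁻¹ - b * (sqrtForm a b p)⁻¹) / 2 := by
  have h0 : p.2 ≠ 0 := Complex.slitPlane_ne_zero hp.2.1
  rw [th2_eq_of_hasFDerivAt Filter.EventuallyEq.rfl (hasFDerivAt_glog hp)]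
  simp
  field_simp

theorem lin2_glog {a b : ℂ} {p : ℂ × ℂ} (hp : p ∈ glogDomain a b) :
    lin2 2 2 1 (glog a b) p =
      (sqrtForm a b p)⁻¹ - (sqrtForm 1 1 p)⁻¹ + glog a b p := by
  have h₃ := Complex.slitPlane_ne_zero hp.2.2.1
  have h₄ := Complex.slitPlane_ne_zero hp.2.2.2
  have e₃ : p.1 ^ ((1 : ℂ) / 2) + p.2 ^ ((1 : ℂ) / 2) = sqrtForm 1 1 p - 1 := by
    simp only [sqrtForm]; ring
  have e₄ : a * p.1 ^ ((1 : ℂ) / 2) + b * p.2 ^ ((1 : ℂ) / 2) = sqrtForm a b p - 1 := by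
    simp only [sqrtForm]; ring
  rw [lin2, th1_glog hp, th2_glog hp]
  linear_combination (sqrtForm 1 1 p)⁻¹ * e₃ - (sqrtForm a b p)⁻¹ * e₄ +
    mul_inv_cancel₀ h₃ - mul_inv_cancel₀ h₄

theorem lin2_lin2_glog {a b : ℂ} {p : ℂ × ℂ} (hp : p ∈ glogDomain a b) :
    lin2 2 2 0 (lin2 2 2 1 (glog a b)) p =
      ((sqrtForm a b p) ^ 2)⁻¹ - ((sqrtForm 1 1 p) ^ 2)⁻¹ := by
  have h₁ := Complex.slitPlane_ne_zero hp.1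
  have h₂ := Complex.slitPlane_ne_zero hp.2.1
  have h₃ := Complex.slitPlane_ne_zero hp.2.2.1
  have h₄ := Complex.slitPlane_ne_zero hp.2.2.2
  have hev : lin2 2 2 1 (glog a b) =ᶠ[nhds p]
      fun q => (sqrtForm a b q)⁻¹ - (sqrtForm 1 1 q)⁻¹ + glog a b q :=
    (eventually_mem_glogDomain hp).mono fun q hq => lin2_glog hq
  have hd := ((hasFDerivAt_inv_sqrtForm a b hp.1 hp.2.1 h₄).sub
    (hasFDerivAt_inv_sqrtForm 1 1 hp.1 hp.2.1 h₃)).add (hasFDerivAt_glog hp)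
  have e₃ : p.1 ^ ((1 : ℂ) / 2) = sqrtForm 1 1 p - 1 - p.2 ^ ((1 : ℂ) / 2) := by
    simp only [sqrtForm]; ring
  have e₄ : a * p.1 ^ ((1 : ℂ) / 2) = sqrtForm a b p - 1 - b * p.2 ^ ((1 : ℂ) / 2) := by
    simp only [sqrtForm]; ring
  rw [lin2, th1_eq_of_hasFDerivAt hev hd, th2_eq_of_hasFDerivAt hev hd]
  generalize sqrtForm 1 1 p = S at *
  generalize sqrtForm a b p = T at *
  generalize p.1 ^ ((1 : ℂ) / 2) = u at *
  generalize p.2 ^ ((1 : ℂ) / 2) = v at *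
  simp
  field_simp
  linear_combination (T ^ 2 * (S + 1)) * e₃ - (S ^ 2 * (T + 1)) * e₄

theorem th1_th1_glog {a b : ℂ} (ha : a ^ 2 = 1) {p : ℂ × ℂ} (hp : p ∈ glogDomain a b) :
    2 * th1 (fun q => 2 * th1 (glog a b) q - glog a b q) p =
      p.1 * (((sqrtForm a b p) ^ 2)⁻¹ - ((sqrtForm 1 1 p) ^ 2)⁻¹) := by
  have h₁ := Complex.slitPlane_ne_zero hp.1
  have h₃ := Complex.slitPlane_ne_zero hp.2.2.1
  have h₄ := Complex.slitPlane_ne_zero hp.2.2.2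
  have hev : (fun q => 2 * th1 (glog a b) q - glog a b q) =ᶠ[nhds p]
      fun q => q.1 ^ ((1 : ℂ) / 2) * ((sqrtForm 1 1 q)⁻¹ - a * (sqrtForm a b q)⁻¹) -
        glog a b q := by
    filter_upwards [eventually_mem_glogDomain hp] with q hq
    rw [th1_glog hq]
    ring
  have hd := ((hasFDerivAt_fst_cpow_half hp.1).mul
    ((hasFDerivAt_inv_sqrtForm 1 1 hp.1 hp.2.1 h₃).sub
      ((hasFDerivAt_inv_sqrtForm a b hp.1 hp.2.1 h₄).const_mul a))).sub (hasFDerivAt_glog hp)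
  have hs := sq_cpow_half p.1
  rw [th1_eq_of_hasFDerivAt hev hd]
  simp only [Pi.sub_apply]
  generalize sqrtForm 1 1 p = S at *
  generalize sqrtForm a b p = T at *
  generalize p.1 ^ ((1 : ℂ) / 2) = u at *
  simp
  field_simp
  linear_combination (S ^ 2 * a ^ 2 - T ^ 2) * hs + S ^ 2 * p.1 * ha

theorem th2_th2_glog {a b : ℂ} (hb : b ^ 2 = 1) {p : ℂ × ℂ} (hp : p ∈ glogDomain a b) :
    2 * th2 (fun q => 2 * th2 (glog a b) q - glog a b q) p =
      p.2 * (((sqrtForm a b p) ^ 2)⁻¹ - ((sqrtForm 1 1 p) ^ 2)⁻¹) := by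
  have h₂ := Complex.slitPlane_ne_zero hp.2.1
  have h₃ := Complex.slitPlane_ne_zero hp.2.2.1
  have h₄ := Complex.slitPlane_ne_zero hp.2.2.2
  have hev : (fun q => 2 * th2 (glog a b) q - glog a b q) =ᶠ[nhds p]
      fun q => q.2 ^ ((1 : ℂ) / 2) * ((sqrtForm 1 1 q)⁻¹ - b * (sqrtForm a b q)⁻¹) -
        glog a b q := by
    filter_upwards [eventually_mem_glogDomain hp] with q hq
    rw [th2_glog hq]
    ring
  have hd := ((hasFDerivAt_snd_cpow_half hp.2.1).mul
    ((hasFDerivAt_inv_sqrtForm 1 1 hp.1 hp.2.1 h₃).sub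
      ((hasFDerivAt_inv_sqrtForm a b hp.1 hp.2.1 h₄).const_mul b))).sub (hasFDerivAt_glog hp)
  have hs := sq_cpow_half p.2
  rw [th2_eq_of_hasFDerivAt hev hd]
  simp only [Pi.sub_apply]
  generalize sqrtForm 1 1 p = S at *
  generalize sqrtForm a b p = T at *
  generalize p.2 ^ ((1 : ℂ) / 2) = v at *
  simp
  field_simp
  linear_combination (S ^ 2 * b ^ 2 - T ^ 2) * hs + S ^ 2 * p.2 * hb

/-- The additional resonant (parameter `c = 0`) logarithmic solutions of the simplicial Horn
system defined by the matrix with rows `(-2,0), (0,-2), (2,2)`: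
`x₁(2θ₁+2θ₂)(2θ₁+2θ₂+1)f = 2θ₁(2θ₁-1)f` and `x₂(2θ₁+2θ₂)(2θ₁+2θ₂+1)f = 2θ₂(2θ₂-1)f`. -/
theorem stmt12 (ε₁ ε₂ : ℂ) (hε₁ : ε₁ = 1 ∨ ε₁ = -1) (hε₂ : ε₂ = 1 ∨ ε₂ = -1)
    (hne : ¬(ε₁ = 1 ∧ ε₂ = 1)) :
    ∀ p : ℂ × ℂ, p.1 ∈ Complex.slitPlane → p.2 ∈ Complex.slitPlane →
      (1 + p.1 ^ ((1 : ℂ) / 2) + p.2 ^ ((1 : ℂ) / 2)) ∈ Complex.slitPlane →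
      (1 + ε₁ * p.1 ^ ((1 : ℂ) / 2) + ε₂ * p.2 ^ ((1 : ℂ) / 2)) ∈ Complex.slitPlane →
      (p.1 * lin2 2 2 0 (lin2 2 2 1 (glog ε₁ ε₂)) p
          = 2 * th1 (fun q => 2 * th1 (glog ε₁ ε₂) q - glog ε₁ ε₂ q) p) ∧
      (p.2 * lin2 2 2 0 (lin2 2 2 1 (glog ε₁ ε₂)) p
          = 2 * th2 (fun q => 2 * th2 (glog ε₁ ε₂) q - glog ε₁ ε₂ q) p) := by
  intro p h₁ h₂ h₃ h₄
  have hp : p ∈ glogDomain ε₁ ε₂ := ⟨h₁, h₂, by simpa only [sqrtForm, one_mul] using h₃, h₄⟩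
  rw [lin2_lin2_glog hp, th1_th1_glog (by rcases hε₁ with rfl | rfl <;> norm_num) hp,
    th2_th2_glog (by rcases hε₂ with rfl | rfl <;> norm_num) hp]
  exact ⟨rfl, rfl⟩
end

section
/- Let c_1, c_2, c_3 ∈ ℂ with c_1 + c_2 + c_3 = 0. Then the function F(x) = x_1^{c_1 + 2c_2} x_2^{−c_1 − c_2} (log(x_1 + x_1² + x_2) − log x_2) (principal branches) satisfies both equations of the Horn system generated by the operators x_1(θ_1 + 2θ_2 + c_1) + (θ_1 + θ_2 − c_2) and x_2(θ_1 + 2θ_2 + c_1)(θ_1 + 2θ_2 + c_1 + 1) − (θ_1 + θ_2 − c_2)(θ_2 − c_3), on the open set {x ∈ ℂ² : x_1 ∉ (−∞,0], x_2 ∉ (−∞,0], x_1 + x_1² + x_2 ∉ (−∞,0]}. (The resonant logarithmic solution of the Horn system defined by the matrix with rows (1,2), (−1,−1), (0,−1) when c_1 + c_2 + c_3 = 0.) -/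
open scoped BigOperators

/-- The first Horn operator `x₁(θ₁ + 2θ₂ + c₁) + (θ₁ + θ₂ - c₂)`. -/
noncomputable def HornOp1 (c₁ c₂ : ℂ) (f : ℂ × ℂ → ℂ) : ℂ × ℂ → ℂ :=
  fun p => p.1 * lin2 1 2 c₁ f p + lin2 1 1 (-c₂) f p

/-- The second Horn operator
`x₂(θ₁ + 2θ₂ + c₁)(θ₁ + 2θ₂ + c₁ + 1) - (θ₁ + θ₂ - c₂)(θ₂ - c₃)`. -/
noncomputable def HornOp2 (c₁ c₂ c₃ : ℂ) (f : ℂ × ℂ → ℂ) : ℂ × ℂ → ℂ :=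
  fun p => p.2 * lin2 1 2 c₁ (lin2 1 2 (c₁ + 1) f) p -
    lin2 1 1 (-c₂) (fun q => th2 f q - c₃ * f q) p

/-- Leibniz rule for the Euler operators on a monomial multiple `x₁^a x₂^b g`. -/
theorem lin2_monomial_mul (a b α β c A B : ℂ) (g : ℂ × ℂ → ℂ) (p : ℂ × ℂ)
    (h1 : p.1 ∈ Complex.slitPlane) (h2 : p.2 ∈ Complex.slitPlane)
    (hg : HasFDerivAt g
      (A • ContinuousLinearMap.fst ℂ ℂ ℂ + B • ContinuousLinearMap.snd ℂ ℂ ℂ) p) :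
    lin2 α β c (fun q => q.1 ^ a * q.2 ^ b * g q) p =
      p.1 ^ a * p.2 ^ b * (α * (p.1 * A) + β * (p.2 * B) + (α * a + β * b + c) * g p) := by
  have n1 := Complex.slitPlane_ne_zero h1
  have n2 := Complex.slitPlane_ne_zero h2
  have d1 := (hasFDerivAt_fst (𝕜 := ℂ) (p := p)).cpow (hasFDerivAt_const a p) h1
  have d2 := (hasFDerivAt_snd (𝕜 := ℂ) (p := p)).cpow (hasFDerivAt_const b p) h2
  have d := ((d1.mul d2).mul hg).fderiv
  have e : (fun q : ℂ × ℂ => q.1 ^ a * q.2 ^ b * g q) =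
      ((fun q : ℂ × ℂ => q.1 ^ a) * fun q : ℂ × ℂ => q.2 ^ b) * g := rfl
  simp only [lin2, th1, th2]
  rw [e, d]
  simp [Complex.cpow_sub _ _ n1, Complex.cpow_sub _ _ n2]
  field_simp
  ring

/-- `lin2` only depends on the germ of the function. -/
theorem lin2_congr {f g : ℂ × ℂ → ℂ} {p : ℂ × ℂ} (h : f =ᶠ[nhds p] g) (α β c : ℂ) :
    lin2 α β c f p = lin2 α β c g p := by
  simp only [lin2, th1, th2, h.fderiv_eq, h.eq_of_nhds]

theorem hasFDerivAt_trinomial (p : ℂ × ℂ) :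
    HasFDerivAt (fun q : ℂ × ℂ => q.1 + q.1 ^ 2 + q.2)
      ((1 + 2 * p.1) • ContinuousLinearMap.fst ℂ ℂ ℂ +
        (1 : ℂ) • ContinuousLinearMap.snd ℂ ℂ ℂ) p := by
  have d1 := hasFDerivAt_fst (𝕜 := ℂ) (p := p)
  have d2 := hasFDerivAt_snd (𝕜 := ℂ) (p := p)
  refine ((d1.add (d1.pow 2)).add d2).congr_fderiv ?_
  ext <;> simp

theorem hasFDerivAt_log_trinomial_sub_log (p : ℂ × ℂ) (h2 : p.2 ∈ Complex.slitPlane)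
    (hS : p.1 + p.1 ^ 2 + p.2 ∈ Complex.slitPlane) :
    HasFDerivAt
      (fun q : ℂ × ℂ => Complex.log (q.1 + q.1 ^ 2 + q.2) - Complex.log q.2)
      (((1 + 2 * p.1) / (p.1 + p.1 ^ 2 + p.2)) • ContinuousLinearMap.fst ℂ ℂ ℂ +
        (1 / (p.1 + p.1 ^ 2 + p.2) - 1 / p.2) • ContinuousLinearMap.snd ℂ ℂ ℂ) p := by
  refine (((hasFDerivAt_trinomial p).clog hS).sub
    ((hasFDerivAt_snd (𝕜 := ℂ) (p := p)).clog h2)).congr_fderiv ?_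
  ext <;> simp <;> ring

theorem hasFDerivAt_inv_trinomial (p : ℂ × ℂ) (hS : p.1 + p.1 ^ 2 + p.2 ≠ 0) :
    HasFDerivAt (fun q : ℂ × ℂ => (q.1 + q.1 ^ 2 + q.2)⁻¹)
      ((-(1 + 2 * p.1) / (p.1 + p.1 ^ 2 + p.2) ^ 2) • ContinuousLinearMap.fst ℂ ℂ ℂ +
        (-1 / (p.1 + p.1 ^ 2 + p.2) ^ 2) • ContinuousLinearMap.snd ℂ ℂ ℂ) p := by
  refine ((hasDerivAt_inv hS).comp_hasFDerivAt p (hasFDerivAt_trinomial p)).congr_fderiv ?_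
  ext <;> simp <;> ring

/-- The resonant logarithmic solution
`F(x) = x₁^{c₁+2c₂} x₂^{-c₁-c₂} (log(x₁ + x₁² + x₂) - log x₂)` of the Horn system defined by
the matrix with rows `(1,2), (-1,-1), (0,-1)` when `c₁ + c₂ + c₃ = 0`. -/
theorem stmt17 (c₁ c₂ c₃ : ℂ) (hres : c₁ + c₂ + c₃ = 0) :
    ∀ p : ℂ × ℂ, p.1 ∈ Complex.slitPlane → p.2 ∈ Complex.slitPlane →
      (p.1 + p.1 ^ 2 + p.2) ∈ Complex.slitPlane →
      HornOp1 c₁ c₂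
        (fun q => q.1 ^ (c₁ + 2 * c₂) * q.2 ^ (-c₁ - c₂) *
          (Complex.log (q.1 + q.1 ^ 2 + q.2) - Complex.log q.2)) p = 0 ∧
      HornOp2 c₁ c₂ c₃
        (fun q => q.1 ^ (c₁ + 2 * c₂) * q.2 ^ (-c₁ - c₂) *
          (Complex.log (q.1 + q.1 ^ 2 + q.2) - Complex.log q.2)) p = 0 := by
  intro p h1 h2 hS
  have n2 := Complex.slitPlane_ne_zero h2
  have nS := Complex.slitPlane_ne_zero hS
  obtain rfl : c₃ = -c₁ - c₂ := by linear_combination hres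
  have hL := hasFDerivAt_log_trinomial_sub_log p h2 hS
  have hI := hasFDerivAt_inv_trinomial p nS
  have d1 := hasFDerivAt_fst (𝕜 := ℂ) (p := p)
  have hev : ∀ᶠ q : ℂ × ℂ in nhds p, q.1 ∈ Complex.slitPlane ∧ q.2 ∈ Complex.slitPlane ∧
      q.1 + q.1 ^ 2 + q.2 ∈ Complex.slitPlane := by
    refine (continuousAt_fst.eventually (Complex.isOpen_slitPlane.mem_nhds h1)).and
      ((continuousAt_snd.eventually (Complex.isOpen_slitPlane.mem_nhds h2)).and ?_)
    exact (hasFDerivAt_trinomial p).continuousAt.eventually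
      (Complex.isOpen_slitPlane.mem_nhds hS)
  constructor
  · simp only [HornOp1]
    rw [lin2_monomial_mul _ _ _ _ _ _ _ _ p h1 h2 hL, lin2_monomial_mul _ _ _ _ _ _ _ _ p h1 h2 hL]
    generalize hs : p.1 + p.1 ^ 2 + p.2 = s at nS ⊢
    field_simp
    rw [← hs]
    ring
  · simp only [HornOp2]
    have e1 : lin2 1 2 (c₁ + 1) (fun q : ℂ × ℂ => q.1 ^ (c₁ + 2 * c₂) * q.2 ^ (-c₁ - c₂) *
          (Complex.log (q.1 + q.1 ^ 2 + q.2) - Complex.log q.2)) =ᶠ[nhds p]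
        fun q => q.1 ^ (c₁ + 2 * c₂) * q.2 ^ (-c₁ - c₂) *
          ((Complex.log (q.1 + q.1 ^ 2 + q.2) - Complex.log q.2) -
            q.1 * (q.1 + q.1 ^ 2 + q.2)⁻¹) := by
      filter_upwards [hev] with q ⟨k1, k2, kS⟩
      have m2 := Complex.slitPlane_ne_zero k2
      have mS := Complex.slitPlane_ne_zero kS
      rw [lin2_monomial_mul _ _ _ _ _ _ _ _ q k1 k2 (hasFDerivAt_log_trinomial_sub_log q k2 kS)]
      generalize hs : q.1 + q.1 ^ 2 + q.2 = s at mS ⊢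
      field_simp
      rw [← hs]
      ring
    have e2 : (fun q : ℂ × ℂ => th2 (fun q : ℂ × ℂ => q.1 ^ (c₁ + 2 * c₂) * q.2 ^ (-c₁ - c₂) *
          (Complex.log (q.1 + q.1 ^ 2 + q.2) - Complex.log q.2)) q -
          (-c₁ - c₂) * (q.1 ^ (c₁ + 2 * c₂) * q.2 ^ (-c₁ - c₂) *
          (Complex.log (q.1 + q.1 ^ 2 + q.2) - Complex.log q.2))) =ᶠ[nhds p]
        fun q => q.1 ^ (c₁ + 2 * c₂) * q.2 ^ (-c₁ - c₂) *
          (q.2 * (q.1 + q.1 ^ 2 + q.2)⁻¹ - 1) := by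
      filter_upwards [hev] with q ⟨k1, k2, kS⟩
      have m2 := Complex.slitPlane_ne_zero k2
      have mS := Complex.slitPlane_ne_zero kS
      have h := lin2_monomial_mul (c₁ + 2 * c₂) (-c₁ - c₂) 0 1 (-(-c₁ - c₂)) _ _ _ q k1 k2
        (hasFDerivAt_log_trinomial_sub_log q k2 kS)
      simp only [lin2] at h
      trans
      swap
      · refine Eq.trans h ?_
        field_simp
        ring
      · ring
    have g1 := (hL.sub (d1.mul hI)).congr_fderiv
      (g' := ((1 + 2 * p.1) / (p.1 + p.1 ^ 2 + p.2) - ((p.1 + p.1 ^ 2 + p.2)⁻¹ +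
          p.1 * (-(1 + 2 * p.1) / (p.1 + p.1 ^ 2 + p.2) ^ 2))) •
            ContinuousLinearMap.fst ℂ ℂ ℂ +
        ((1 / (p.1 + p.1 ^ 2 + p.2) - 1 / p.2) -
          p.1 * (-1 / (p.1 + p.1 ^ 2 + p.2) ^ 2)) • ContinuousLinearMap.snd ℂ ℂ ℂ)
      (by ext <;> simp <;> ring)
    have g2 := (((hasFDerivAt_snd (𝕜 := ℂ) (p := p)).mul hI).sub_const 1).congr_fderiv
      (g' := (p.2 * (-(1 + 2 * p.1) / (p.1 + p.1 ^ 2 + p.2) ^ 2)) •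
            ContinuousLinearMap.fst ℂ ℂ ℂ +
        ((p.1 + p.1 ^ 2 + p.2)⁻¹ + p.2 * (-1 / (p.1 + p.1 ^ 2 + p.2) ^ 2)) •
            ContinuousLinearMap.snd ℂ ℂ ℂ)
      (by ext <;> simp <;> ring)
    have r1 := lin2_monomial_mul (c₁ + 2 * c₂) (-c₁ - c₂) 1 2 c₁ _ _ _ p h1 h2 g1
    have r2 := lin2_monomial_mul (c₁ + 2 * c₂) (-c₁ - c₂) 1 1 (-c₂) _ _ _ p h1 h2 g2
    rw [lin2_congr e1, lin2_congr e2]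
    refine (congrArg₂ (fun u v => p.2 * u - v) r1 r2).trans ?_
    simp only [Pi.sub_apply, Pi.mul_apply]
    generalize hs : p.1 + p.1 ^ 2 + p.2 = s at nS ⊢
    field_simp
    rw [← hs]
    ring
end
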